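/- There exists a constant Θ ≥ 1 such that the following holds. Let T₁ ≤ T₂ with T₁ ≥ Θ, let ρ : [0,1] → (0,∞) be measurable and bounded with ∫₀¹ ρ = 1, let T : [0,1] → (0,∞) be measurable with T₁ ≤ T(y) ≤ T₂ for all y, let f be a mild steady state of the linear BGK equation with data (κ, T₁, T₂, ρ, T) where κ = 1, and assume in addition that the pressure P(x) = ∫_ℝ v² f(x,v) dv is constant in x. Define τ(x) = P(x)/ρ(x). Then there exists a constant C depending only on T₁ and T₂ such that for all x₁, x₂ ∈ [0,1], |τ(x₁) − τ(x₂)| ≤ C √|x₁ − x₂|; i.e. the output temperature profile is 1/2-Hölder continuous with modulus depending only on T₁, T₂. -/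

import Mathlib

open MeasureTheory Real Set

/-- Centered Maxwellian with temperature `T`: `M_T(v) = (2πT)^{-1/2} exp(−v²/(2T))`. -/
noncomputable def Mxw (T v : ℝ) : ℝ :=
  (Real.sqrt (2 * π * T))⁻¹ * Real.exp (-v ^ 2 / (2 * T))

/-- Wall Maxwellian with temperature `T`: `M̃_T(v) = (1/T) exp(−v²/(2T))`,
normalized so that `∫₀^∞ v M̃_T(v) dv = 1`. -/
noncomputable def wallMxw (T v : ℝ) : ℝ :=
  T⁻¹ * Real.exp (-v ^ 2 / (2 * T))

/-- `C_i = ∫₀^∞ v e^{−1/(κv)} M̃_{T_i}(v) dv`. -/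
noncomputable def Cwall (κ T : ℝ) : ℝ :=
  ∫ v in Ioi (0 : ℝ), v * Real.exp (-1 / (κ * v)) * wallMxw T v

/-- `C₋ = (1/κ) ∫₀¹ ρ(y) (∫₀^∞ e^{−y/(κv)} M_{T(y)}(v) dv) dy`. -/
noncomputable def Cminus (κ : ℝ) (ρ T : ℝ → ℝ) : ℝ :=
  κ⁻¹ * ∫ y in Icc (0 : ℝ) 1, ρ y * ∫ v in Ioi (0 : ℝ), Real.exp (-y / (κ * v)) * Mxw (T y) v

/-- `C₊ = (1/κ) ∫₀¹ ρ(y) (∫₀^∞ e^{−(1−y)/(κv)} M_{T(y)}(v) dv) dy`. -/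
noncomputable def Cplus (κ : ℝ) (ρ T : ℝ → ℝ) : ℝ :=
  κ⁻¹ * ∫ y in Icc (0 : ℝ) 1, ρ y * ∫ v in Ioi (0 : ℝ), Real.exp (-(1 - y) / (κ * v)) * Mxw (T y) v

/-- `f` is a mild steady state of the linear BGK equation with data `(κ, T₁, T₂, ρ, T)`. -/
def IsMildSteadyState (κ T₁ T₂ : ℝ) (ρ T : ℝ → ℝ) (f : ℝ → ℝ → ℝ) : Prop :=
  Cwall κ T₁ * Cwall κ T₂ < 1 ∧
  IntegrableOn
    (fun y => ρ y * ∫ v in Ioi (0 : ℝ), Real.exp (-y / (κ * v)) * Mxw (T y) v)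
    (Icc (0 : ℝ) 1) ∧
  IntegrableOn
    (fun y => ρ y * ∫ v in Ioi (0 : ℝ), Real.exp (-(1 - y) / (κ * v)) * Mxw (T y) v)
    (Icc (0 : ℝ) 1) ∧
  (∀ x ∈ Icc (0 : ℝ) 1, ρ x = ∫ v, f x v) ∧
  (∀ x ∈ Icc (0 : ℝ) 1,
    (∀ᵐ v ∂(volume.restrict (Ioi (0 : ℝ))),
      f x v = Real.exp (-x / (κ * v)) * wallMxw T₁ v *
          ((Cminus κ ρ T + Cwall κ T₂ * Cplus κ ρ T) / (1 - Cwall κ T₁ * Cwall κ T₂)) +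
        ∫ y in (0 : ℝ)..x, (κ * v)⁻¹ * Real.exp (-(x - y) / (κ * v)) * ρ y * Mxw (T y) v) ∧
    (∀ᵐ v ∂(volume.restrict (Iio (0 : ℝ))),
      f x v = Real.exp (-(1 - x) / (κ * |v|)) * wallMxw T₂ v *
          ((Cplus κ ρ T + Cwall κ T₁ * Cminus κ ρ T) / (1 - Cwall κ T₁ * Cwall κ T₂)) +
        ∫ y in x..1, (κ * |v|)⁻¹ * Real.exp (-(y - x) / (κ * |v|)) * ρ y * Mxw (T y) v))

/-- Free transport from the wall at `0` with speed `w`: incoming value `a`, source `q`. -/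
noncomputable def transportProfile (w a : ℝ) (q : ℝ → ℝ) (x : ℝ) : ℝ :=
  Real.exp (-x / w) * a + ∫ y in (0 : ℝ)..x, w⁻¹ * Real.exp (-(x - y) / w) * q y

lemma one_sub_exp_neg_le_sqrt {u : ℝ} (hu : 0 ≤ u) : 1 - Real.exp (-u) ≤ Real.sqrt u := by
  apply Real.le_sqrt_of_sq_le
  have h1 : 1 - Real.exp (-u) ≤ u := by linarith [Real.add_one_le_exp (-u)]
  have h2 : 0 ≤ 1 - Real.exp (-u) := by linarith [Real.exp_le_one_iff.2 (neg_nonpos.2 hu)]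
  have h3 : 1 - Real.exp (-u) ≤ 1 := by linarith [Real.exp_pos (-u)]
  nlinarith

lemma integral_transport_kernel (w a x : ℝ) :
    ∫ y in a..x, w⁻¹ * Real.exp (-(x - y) / w) = 1 - Real.exp (-(x - a) / w) := by
  have h : ∀ y ∈ uIcc a x, HasDerivAt (fun y => Real.exp (-(x - y) / w))
      (w⁻¹ * Real.exp (-(x - y) / w)) y := by
    intro y _
    have h1 : HasDerivAt (fun y => -(x - y) / w) (w⁻¹) y := by
      have := (((hasDerivAt_id y).const_sub x).neg).div_const w
      simpa using this
    simpa [mul_comm] using h1.exp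
  rw [intervalIntegral.integral_eq_sub_of_hasDerivAt h
    (Continuous.intervalIntegrable (by fun_prop) _ _)]
  simp

section Source

variable {w b : ℝ} {q : ℝ → ℝ}

lemma intervalIntegrable_of_bounded (hq : Measurable q)
    (hqb : ∀ y ∈ Icc (0 : ℝ) 1, 0 ≤ q y ∧ q y ≤ b) {s t : ℝ} (hs : s ∈ Icc (0 : ℝ) 1)
    (ht : t ∈ Icc (0 : ℝ) 1) : IntervalIntegrable q volume s t := by
  refine IntervalIntegrable.mono_fun' (g := fun _ => b) (by simp) hq.aestronglyMeasurable ?_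
  refine (ae_restrict_mem measurableSet_uIoc).mono fun y hy => ?_
  change ‖q y‖ ≤ b
  have hy' : y ∈ Icc (0 : ℝ) 1 := by
    have := uIoc_subset_uIcc hy
    exact (uIcc_subset_Icc hs ht) this
  rw [Real.norm_of_nonneg (hqb y hy').1]
  exact (hqb y hy').2

lemma intervalIntegrable_transport (hq : Measurable q)
    (hqb : ∀ y ∈ Icc (0 : ℝ) 1, 0 ≤ q y ∧ q y ≤ b) (x : ℝ) {s t : ℝ} (hs : s ∈ Icc (0 : ℝ) 1)
    (ht : t ∈ Icc (0 : ℝ) 1) :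
    IntervalIntegrable (fun y => w⁻¹ * Real.exp (-(x - y) / w) * q y) volume s t :=
  (intervalIntegrable_of_bounded hq hqb hs ht).continuousOn_mul
    (by fun_prop)

lemma integral_transport_nonneg (hw : 0 < w)
    (hqb : ∀ y ∈ Icc (0 : ℝ) 1, 0 ≤ q y ∧ q y ≤ b) {s x : ℝ}
    (hs : 0 ≤ s) (hsx : s ≤ x) (hx : x ≤ 1) :
    0 ≤ ∫ y in s..x, w⁻¹ * Real.exp (-(x - y) / w) * q y := by
  refine intervalIntegral.integral_nonneg hsx fun y hy => ?_
  have := (hqb y ⟨hs.trans hy.1, hy.2.trans hx⟩).1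
  positivity

lemma integral_transport_le (hw : 0 < w) (hq : Measurable q)
    (hqb : ∀ y ∈ Icc (0 : ℝ) 1, 0 ≤ q y ∧ q y ≤ b) {s x : ℝ}
    (hs : 0 ≤ s) (hsx : s ≤ x) (hx : x ≤ 1) :
    ∫ y in s..x, w⁻¹ * Real.exp (-(x - y) / w) * q y ≤ b * (1 - Real.exp (-(x - s) / w)) := by
  rw [← integral_transport_kernel, ← intervalIntegral.integral_const_mul]
  refine intervalIntegral.integral_mono_on hsx
    (intervalIntegrable_transport hq hqb x ⟨hs, hsx.trans hx⟩ ⟨hs.trans hsx, hx⟩)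
    (Continuous.intervalIntegrable (by fun_prop) _ _) fun y hy => ?_
  have := (hqb y ⟨hs.trans hy.1, hy.2.trans hx⟩).2
  rw [mul_comm b]
  gcongr

lemma integral_transport_le_mass (hw : 0 < w) (hq : Measurable q)
    (hqb : ∀ y ∈ Icc (0 : ℝ) 1, 0 ≤ q y ∧ q y ≤ b) {x : ℝ} (hx : x ∈ Icc (0 : ℝ) 1) :
    ∫ y in (0 : ℝ)..x, w⁻¹ * Real.exp (-(x - y) / w) * q y ≤ w⁻¹ * ∫ y in (0 : ℝ)..1, q y := by
  have h0 : (0 : ℝ) ∈ Icc (0 : ℝ) 1 := by simp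
  have h1 : (1 : ℝ) ∈ Icc (0 : ℝ) 1 := by simp
  have hsplit := intervalIntegral.integral_add_adjacent_intervals
    (intervalIntegrable_of_bounded hq hqb h0 hx) (intervalIntegrable_of_bounded hq hqb hx h1)
  have hrest : 0 ≤ ∫ y in x..1, q y :=
    intervalIntegral.integral_nonneg hx.2 fun y hy => (hqb y ⟨hx.1.trans hy.1, hy.2⟩).1
  calc _ ≤ ∫ y in (0 : ℝ)..x, w⁻¹ * q y := by
        refine intervalIntegral.integral_mono_on hx.1
          (intervalIntegrable_transport hq hqb x h0 hx)
          ((intervalIntegrable_of_bounded hq hqb h0 hx).const_mul _) fun y hy => ?_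
        have hy0 := (hqb y ⟨hy.1, hy.2.trans hx.2⟩).1
        have he : Real.exp (-(x - y) / w) ≤ 1 :=
          Real.exp_le_one_iff.2 (div_nonpos_of_nonpos_of_nonneg (by linarith [hy.2]) hw.le)
        have : w⁻¹ * Real.exp (-(x - y) / w) ≤ w⁻¹ := mul_le_of_le_one_right (by positivity) he
        gcongr
    _ = w⁻¹ * ∫ y in (0 : ℝ)..x, q y := intervalIntegral.integral_const_mul _ _
    _ ≤ _ := by
        have : 0 < w⁻¹ := by positivity
        gcongr
        linarith

lemma le_integral_transport (hw : 0 < w) (hq : Measurable q)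
    (hqb : ∀ y ∈ Icc (0 : ℝ) 1, 0 ≤ q y ∧ q y ≤ b) {x : ℝ} (hx : x ∈ Icc (0 : ℝ) 1) :
    w⁻¹ * Real.exp (-1 / w) * ∫ y in (0 : ℝ)..x, q y ≤
      ∫ y in (0 : ℝ)..x, w⁻¹ * Real.exp (-(x - y) / w) * q y := by
  have h0 : (0 : ℝ) ∈ Icc (0 : ℝ) 1 := by simp
  rw [← intervalIntegral.integral_const_mul]
  refine intervalIntegral.integral_mono_on hx.1
    ((intervalIntegrable_of_bounded hq hqb h0 hx).const_mul _)
    (intervalIntegrable_transport hq hqb x h0 hx) fun y hy => ?_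
  have hy0 := (hqb y ⟨hy.1, hy.2.trans hx.2⟩).1
  have : -1 ≤ -(x - y) := by linarith [hy.1, hx.2]
  gcongr

variable {a : ℝ}

lemma transportProfile_le (hw : 0 < w) (ha : 0 ≤ a) (hb : 0 ≤ b) (hq : Measurable q)
    (hqb : ∀ y ∈ Icc (0 : ℝ) 1, 0 ≤ q y ∧ q y ≤ b) {x : ℝ} (hx : x ∈ Icc (0 : ℝ) 1) :
    transportProfile w a q x ≤ a + b := by
  have h1 := integral_transport_le hw hq hqb le_rfl hx.1 hx.2
  have h2 : Real.exp (-x / w) ≤ 1 :=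
    Real.exp_le_one_iff.2 (div_nonpos_of_nonpos_of_nonneg (by linarith [hx.1]) hw.le)
  have h3 : Real.exp (-x / w) * a ≤ a := mul_le_of_le_one_left ha h2
  have h4 : b * (1 - Real.exp (-(x - 0) / w)) ≤ b :=
    mul_le_of_le_one_right hb (by linarith [Real.exp_pos (-(x - 0) / w)])
  unfold transportProfile
  linarith

lemma transportProfile_le_sqrt (hw : 0 < w) (ha : 0 ≤ a) {R e : ℝ} (hR : 0 ≤ R) (he : 0 ≤ e)
    (hq : Measurable q) (hqb : ∀ y ∈ Icc (0 : ℝ) 1, 0 ≤ q y ∧ q y ≤ R * e)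
    (hm : ∫ y in (0 : ℝ)..1, q y ≤ e) {x : ℝ} (hx : x ∈ Icc (0 : ℝ) 1) :
    transportProfile w a q x ≤ a + Real.sqrt R * (Real.sqrt w)⁻¹ * e := by
  have h2 : Real.exp (-x / w) ≤ 1 :=
    Real.exp_le_one_iff.2 (div_nonpos_of_nonpos_of_nonneg (by linarith [hx.1]) hw.le)
  have h3 : Real.exp (-x / w) * a ≤ a := mul_le_of_le_one_left ha h2
  have h1 := integral_transport_le hw hq hqb le_rfl hx.1 hx.2
  have h4 : R * e * (1 - Real.exp (-(x - 0) / w)) ≤ R * e :=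
    mul_le_of_le_one_right (by positivity) (by linarith [Real.exp_pos (-(x - 0) / w)])
  have h5 := integral_transport_le_mass hw hq hqb hx
  have h6 : w⁻¹ * ∫ y in (0 : ℝ)..1, q y ≤ w⁻¹ * e := by gcongr
  have h0 := integral_transport_nonneg hw hqb le_rfl hx.1 hx.2
  set J := ∫ y in (0 : ℝ)..x, w⁻¹ * Real.exp (-(x - y) / w) * q y with hJ
  have h7 : J ≤ Real.sqrt R * (Real.sqrt w)⁻¹ * e := by
    have hJ1 : J ≤ R * e := by linarith
    have hJ2 : J ≤ w⁻¹ * e := by linarith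
    refine abs_le_of_sq_le_sq' ?_ (by positivity) |>.2
    calc J ^ 2 = J * J := sq J
      _ ≤ (R * e) * (w⁻¹ * e) := by gcongr
      _ = _ := by
        rw [mul_pow, mul_pow, inv_pow, Real.sq_sqrt hR, Real.sq_sqrt hw.le]; ring
  unfold transportProfile
  linarith

lemma abs_transportProfile_sub_le_of_le (hw : 0 < w) (ha : 0 ≤ a)
    (hq : Measurable q) (hqb : ∀ y ∈ Icc (0 : ℝ) 1, 0 ≤ q y ∧ q y ≤ b) {x₁ x₂ : ℝ}
    (hx₁ : x₁ ∈ Icc (0 : ℝ) 1) (hx₂ : x₂ ∈ Icc (0 : ℝ) 1) (hx : x₁ ≤ x₂) :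
    |transportProfile w a q x₁ - transportProfile w a q x₂| ≤
      (a + b) * Real.sqrt (x₂ - x₁) * (Real.sqrt w)⁻¹ := by
  have h0 : (0 : ℝ) ∈ Icc (0 : ℝ) 1 := by simp
  have hb : 0 ≤ b := (hqb 0 h0).1.trans (hqb 0 h0).2
  set k := Real.exp (-(x₂ - x₁) / w) with hk
  set I := ∫ y in x₁..x₂, w⁻¹ * Real.exp (-(x₂ - y) / w) * q y with hI
  have hrec : transportProfile w a q x₂ = k * transportProfile w a q x₁ + I := by
    unfold transportProfile
    rw [← intervalIntegral.integral_add_adjacent_intervals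
      (intervalIntegrable_transport hq hqb x₂ h0 hx₁)
      (intervalIntegrable_transport hq hqb x₂ hx₁ hx₂), mul_add, ← mul_assoc, hk, ← Real.exp_add,
      ← intervalIntegral.integral_const_mul, ← add_assoc]
    congr 2
    · congr 2; ring
    · refine intervalIntegral.integral_congr fun y _ => ?_
      have : Real.exp (-(x₂ - y) / w) =
          Real.exp (-(x₂ - x₁) / w) * Real.exp (-(x₁ - y) / w) := by
        rw [← Real.exp_add]; congr 1; ring
      simp only [this]; ring
  have hI0 : 0 ≤ I := integral_transport_nonneg hw hqb hx₁.1 hx hx₂.2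
  have hIb : I ≤ b * (1 - k) := integral_transport_le hw hq hqb hx₁.1 hx hx₂.2
  have hP := transportProfile_le hw ha hb hq hqb hx₁
  have hP0 : 0 ≤ transportProfile w a q x₁ := by
    have := integral_transport_nonneg hw hqb le_rfl hx₁.1 hx₁.2
    unfold transportProfile
    positivity
  have hk1 : 0 ≤ 1 - k := by
    have : k ≤ 1 := Real.exp_le_one_iff.2
      (div_nonpos_of_nonpos_of_nonneg (by linarith) hw.le)
    linarith
  have hks : 1 - k ≤ Real.sqrt (x₂ - x₁) * (Real.sqrt w)⁻¹ := by
    have := one_sub_exp_neg_le_sqrt (u := (x₂ - x₁) / w) (div_nonneg (by linarith) hw.le)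
    rw [Real.sqrt_div (by linarith), ← neg_div] at this
    rwa [← div_eq_mul_inv]
  have hmain : |transportProfile w a q x₁ - transportProfile w a q x₂| ≤ (a + b) * (1 - k) := by
    rw [hrec, abs_le]
    constructor <;> nlinarith [mul_nonneg ha hk1, mul_nonneg hb hk1]
  calc _ ≤ (a + b) * (1 - k) := hmain
    _ ≤ (a + b) * (Real.sqrt (x₂ - x₁) * (Real.sqrt w)⁻¹) := by gcongr
    _ = _ := by ring

lemma abs_transportProfile_sub_le (hw : 0 < w) (ha : 0 ≤ a)
    (hq : Measurable q) (hqb : ∀ y ∈ Icc (0 : ℝ) 1, 0 ≤ q y ∧ q y ≤ b) {x₁ x₂ : ℝ}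
    (hx₁ : x₁ ∈ Icc (0 : ℝ) 1) (hx₂ : x₂ ∈ Icc (0 : ℝ) 1) :
    |transportProfile w a q x₁ - transportProfile w a q x₂| ≤
      (a + b) * Real.sqrt |x₁ - x₂| * (Real.sqrt w)⁻¹ := by
  rcases le_total x₁ x₂ with h | h
  · rw [abs_sub_comm x₁, abs_of_nonneg (sub_nonneg.2 h)]
    exact abs_transportProfile_sub_le_of_le hw ha hq hqb hx₁ hx₂ h
  · rw [abs_sub_comm, abs_of_nonneg (sub_nonneg.2 h)]
    exact abs_transportProfile_sub_le_of_le hw ha hq hqb hx₂ hx₁ h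

end Source

section Gaussian

variable {T : ℝ}

lemma integrable_gaussian (hT : 0 < T) : Integrable fun v : ℝ => Real.exp (-v ^ 2 / (2 * T)) := by
  refine (integrable_exp_neg_mul_sq (b := (2 * T)⁻¹) (by positivity)).congr (ae_of_all _ fun v => ?_)
  simp only
  congr 1
  field_simp

lemma integrable_sq_mul_gaussian (hT : 0 < T) :
    Integrable fun v : ℝ => v ^ 2 * Real.exp (-v ^ 2 / (2 * T)) := by
  refine (integrable_rpow_mul_exp_neg_mul_sq (b := (2 * T)⁻¹) (s := 2) (by positivity)
    (by norm_num)).congr (ae_of_all _ fun v => ?_)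
  simp only [Real.rpow_two]
  congr 2
  field_simp

lemma integrable_inv_sqrt_abs_mul_gaussian (hT : 0 < T) :
    Integrable fun v : ℝ => (Real.sqrt |v|)⁻¹ * Real.exp (-v ^ 2 / (2 * T)) := by
  have h : IntegrableOn (fun v : ℝ => (Real.sqrt v)⁻¹ * Real.exp (-v ^ 2 / (2 * T))) (Ioi 0) := by
    refine (integrableOn_rpow_mul_exp_neg_mul_sq (b := (2 * T)⁻¹) (s := -(1 / 2)) (by positivity)
      (by norm_num)).congr_fun (fun v hv => ?_) measurableSet_Ioi
    simp only [Real.rpow_neg (le_of_lt hv), ← Real.sqrt_eq_rpow]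
    congr 2
    field_simp
  have hpos : IntegrableOn (fun v : ℝ => (Real.sqrt |v|)⁻¹ * Real.exp (-v ^ 2 / (2 * T))) (Ioi 0) :=
    h.congr_fun (fun v hv => by simp only [abs_of_pos (show 0 < v from hv)]) measurableSet_Ioi
  rw [← integrableOn_univ, ← Iio_union_Ici (a := (0 : ℝ)), integrableOn_union,
    integrableOn_Ici_iff_integrableOn_Ioi]
  refine ⟨?_, hpos⟩
  rw [← (Measure.measurePreserving_neg (volume : Measure ℝ)).integrableOn_comp_preimage
      (Homeomorph.neg ℝ).measurableEmbedding]
  simpa only [Function.comp_def, neg_sq, abs_neg, neg_preimage, neg_Iio, neg_zero] using hpos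

end Gaussian

section Maxwellian

variable {T T₂ : ℝ}

lemma gaussian_le (hT : 0 < T) (hT₂ : T ≤ T₂) (v : ℝ) :
    Real.exp (-v ^ 2 / (2 * T)) ≤ Real.exp (-v ^ 2 / (2 * T₂)) := by
  rw [Real.exp_le_exp, neg_div, neg_div, neg_le_neg_iff]
  gcongr

lemma Mxw_nonneg (T v : ℝ) : 0 ≤ Mxw T v := by
  unfold Mxw; positivity

lemma Mxw_le_gaussian (hT : 1 ≤ T) (hT₂ : T ≤ T₂) (v : ℝ) :
    Mxw T v ≤ Real.exp (-v ^ 2 / (2 * T₂)) := by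
  have h1 : (Real.sqrt (2 * π * T))⁻¹ ≤ 1 := by
    refine inv_le_one_of_one_le₀ (Real.one_le_sqrt.2 ?_)
    nlinarith [Real.pi_gt_three]
  unfold Mxw
  exact (mul_le_of_le_one_left (Real.exp_nonneg _) h1).trans (gaussian_le (by linarith) hT₂ v)

lemma wallMxw_nonneg (hT : 0 < T) (v : ℝ) : 0 ≤ wallMxw T v := by
  unfold wallMxw; positivity

lemma wallMxw_le_gaussian (hT : 1 ≤ T) (hT₂ : T ≤ T₂) (v : ℝ) :
    wallMxw T v ≤ Real.exp (-v ^ 2 / (2 * T₂)) := by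
  unfold wallMxw
  exact (mul_le_of_le_one_left (Real.exp_nonneg _) (inv_le_one_of_one_le₀ hT)).trans
    (gaussian_le (by linarith) hT₂ v)

lemma le_Mxw (hT : 1 ≤ T) (hT₂ : T ≤ T₂) {v : ℝ} (hv : |v| ≤ 2) :
    (Real.sqrt (2 * π * T₂))⁻¹ * Real.exp (-2) ≤ Mxw T v := by
  have hv2 : v ^ 2 ≤ 4 := by
    have := (abs_le.1 hv)
    nlinarith
  have h1 : -2 ≤ -v ^ 2 / (2 * T) := by
    rw [le_div_iff₀ (by linarith)]; nlinarith
  have : 0 < Real.sqrt (2 * π * T) := Real.sqrt_pos.2 (by positivity)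
  unfold Mxw
  gcongr

lemma measurable_Mxw_comp {g : ℝ → ℝ} (hg : Measurable g) (v : ℝ) :
    Measurable fun y => Mxw (g y) v := by
  unfold Mxw; fun_prop

lemma Cwall_nonneg (κ : ℝ) (hT : 0 < T) : 0 ≤ Cwall κ T :=
  setIntegral_nonneg measurableSet_Ioi fun v hv => by
    have := wallMxw_nonneg hT v
    have : 0 < v := hv
    positivity

end Maxwellian

lemma attenuated_mass_bounds {T₂ : ℝ} {ρ T s : ℝ → ℝ} (hT₂ : 0 < T₂)
    (hρ : ∀ y ∈ Icc (0 : ℝ) 1, 0 ≤ ρ y) (hmass : ∫ y in Icc (0 : ℝ) 1, ρ y = 1)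
    (hT : ∀ y ∈ Icc (0 : ℝ) 1, 1 ≤ T y ∧ T y ≤ T₂) (hs : ∀ y ∈ Icc (0 : ℝ) 1, 0 ≤ s y) :
    0 ≤ (∫ y in Icc (0 : ℝ) 1, ρ y * ∫ v in Ioi (0 : ℝ), Real.exp (-s y / v) * Mxw (T y) v) ∧
    (∫ y in Icc (0 : ℝ) 1, ρ y * ∫ v in Ioi (0 : ℝ), Real.exp (-s y / v) * Mxw (T y) v) ≤
      ∫ v : ℝ, Real.exp (-v ^ 2 / (2 * T₂)) := by
  have hin0 : ∀ y, 0 ≤ ∫ v in Ioi (0 : ℝ), Real.exp (-s y / v) * Mxw (T y) v := fun y =>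
    integral_nonneg fun v => mul_nonneg (Real.exp_nonneg _) (Mxw_nonneg _ _)
  refine ⟨setIntegral_nonneg measurableSet_Icc fun y hy => mul_nonneg (hρ y hy) (hin0 y), ?_⟩
  set c := ∫ v : ℝ, Real.exp (-v ^ 2 / (2 * T₂)) with hc
  have hin : ∀ y ∈ Icc (0 : ℝ) 1,
      (∫ v in Ioi (0 : ℝ), Real.exp (-s y / v) * Mxw (T y) v) ≤ c := by
    intro y hy
    refine le_trans (integral_mono_of_nonneg
      (ae_of_all _ fun v => mul_nonneg (Real.exp_nonneg _) (Mxw_nonneg _ _))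
      (integrable_gaussian hT₂).integrableOn ?_)
      (setIntegral_le_integral (integrable_gaussian hT₂) (ae_of_all _ fun v => Real.exp_nonneg _))
    refine (ae_restrict_mem measurableSet_Ioi).mono fun v hv => ?_
    have hv : 0 < v := hv
    have he : Real.exp (-s y / v) ≤ 1 := Real.exp_le_one_iff.2
      (div_nonpos_of_nonpos_of_nonneg (by linarith [hs y hy]) hv.le)
    exact (mul_le_of_le_one_left (Mxw_nonneg _ _) he).trans
      (Mxw_le_gaussian (hT y hy).1 (hT y hy).2 v)
  have hρi : IntegrableOn ρ (Icc 0 1) := Integrable.of_integral_ne_zero (by rw [hmass]; simp)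
  calc _ ≤ ∫ y in Icc (0 : ℝ) 1, ρ y * c := by
        refine integral_mono_of_nonneg ?_ (hρi.mul_const c) ?_
        · exact (ae_restrict_mem measurableSet_Icc).mono fun y hy => mul_nonneg (hρ y hy) (hin0 y)
        · exact (ae_restrict_mem measurableSet_Icc).mono fun y hy =>
            mul_le_mul_of_nonneg_left (hin y hy) (hρ y hy)
    _ = c := by rw [integral_mul_const, hmass, one_mul]

/-- Distance from `x` to the wall from which particles of velocity `v` enter. -/
noncomputable def wallDist (v x : ℝ) : ℝ := if 0 < v then x else 1 - x

/-- Re-emission source `ρ M_T` seen from the wall of entry of the velocity `v`. -/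
noncomputable def source (ρ T : ℝ → ℝ) (v y : ℝ) : ℝ :=
  ρ (wallDist v y) * Mxw (T (wallDist v y)) v

/-- Density entering at the wall with velocity `v`, given the wall fluxes. -/
noncomputable def inflow (T₁ T₂ α β v : ℝ) : ℝ :=
  if 0 < v then wallMxw T₁ v * α else wallMxw T₂ v * β

lemma wallDist_mem (v : ℝ) {x : ℝ} (hx : x ∈ Icc (0 : ℝ) 1) : wallDist v x ∈ Icc (0 : ℝ) 1 := by
  unfold wallDist
  split_ifs
  · exact hx
  · exact ⟨by linarith [hx.2], by linarith [hx.1]⟩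

lemma abs_wallDist_sub (v x y : ℝ) : |wallDist v x - wallDist v y| = |x - y| := by
  unfold wallDist
  split_ifs
  · rfl
  · rw [abs_sub_comm x]; congr 1; ring

lemma measurable_wallDist (v : ℝ) : Measurable (wallDist v) := by
  unfold wallDist
  split_ifs <;> fun_prop

lemma integral_comp_wallDist (v : ℝ) (ρ : ℝ → ℝ) (x : ℝ) :
    ∫ y in (0 : ℝ)..wallDist v x, ρ (wallDist v y) =
      if 0 < v then ∫ y in (0 : ℝ)..x, ρ y else ∫ y in x..1, ρ y := by
  unfold wallDist
  split_ifs
  · rfl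
  · rw [intervalIntegral.integral_comp_sub_left ρ 1]; simp

lemma integral_comp_wallDist_unit (v : ℝ) (ρ : ℝ → ℝ) :
    ∫ y in (0 : ℝ)..1, ρ (wallDist v y) = ∫ y in (0 : ℝ)..1, ρ y := by
  unfold wallDist
  split_ifs
  · rfl
  · rw [intervalIntegral.integral_comp_sub_left ρ 1]; simp

section Source

variable {ρ T : ℝ → ℝ} {T₂ R : ℝ}

lemma measurable_source (hρ : Measurable ρ) (hT : Measurable T) (v : ℝ) :
    Measurable (source ρ T v) :=
  (hρ.comp (measurable_wallDist v)).mul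
    (measurable_Mxw_comp (hT.comp (measurable_wallDist v)) v)

lemma source_bounds (hρ0 : ∀ y ∈ Icc (0 : ℝ) 1, 0 ≤ ρ y) (hρR : ∀ y ∈ Icc (0 : ℝ) 1, ρ y ≤ R)
    (hT : ∀ y ∈ Icc (0 : ℝ) 1, 1 ≤ T y ∧ T y ≤ T₂) (v : ℝ) :
    ∀ y ∈ Icc (0 : ℝ) 1,
      0 ≤ source ρ T v y ∧ source ρ T v y ≤ R * Real.exp (-v ^ 2 / (2 * T₂)) := by
  intro y hy
  have hy' := wallDist_mem v hy
  have h0 := hρ0 _ hy'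
  have hR := hρR _ hy'
  have hM := Mxw_nonneg (T (wallDist v y)) v
  have hM' := Mxw_le_gaussian (hT _ hy').1 (hT _ hy').2 v
  exact ⟨mul_nonneg h0 hM, mul_le_mul hR hM' hM (h0.trans hR)⟩

lemma intervalIntegrable_comp_wallDist (hρ : Measurable ρ)
    (hρ0 : ∀ y ∈ Icc (0 : ℝ) 1, 0 ≤ ρ y) (hρR : ∀ y ∈ Icc (0 : ℝ) 1, ρ y ≤ R) (v : ℝ) {x : ℝ}
    (hx : x ∈ Icc (0 : ℝ) 1) :
    IntervalIntegrable (fun y => ρ (wallDist v y)) volume 0 x :=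
  intervalIntegrable_of_bounded (b := R) (hρ.comp (measurable_wallDist v))
    (fun y hy => ⟨hρ0 _ (wallDist_mem v hy), hρR _ (wallDist_mem v hy)⟩) (by simp) hx

lemma integral_source_le (hρ : Measurable ρ) (hTm : Measurable T)
    (hρ0 : ∀ y ∈ Icc (0 : ℝ) 1, 0 ≤ ρ y) (hρR : ∀ y ∈ Icc (0 : ℝ) 1, ρ y ≤ R)
    (hmass : ∫ y in (0 : ℝ)..1, ρ y = 1)
    (hT : ∀ y ∈ Icc (0 : ℝ) 1, 1 ≤ T y ∧ T y ≤ T₂) (v : ℝ) :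
    ∫ y in (0 : ℝ)..1, source ρ T v y ≤ Real.exp (-v ^ 2 / (2 * T₂)) := by
  have h1 : (1 : ℝ) ∈ Icc (0 : ℝ) 1 := by simp
  calc _ ≤ ∫ y in (0 : ℝ)..1, ρ (wallDist v y) * Real.exp (-v ^ 2 / (2 * T₂)) := by
        refine intervalIntegral.integral_mono_on zero_le_one
          (intervalIntegrable_of_bounded (measurable_source hρ hTm v)
            (source_bounds hρ0 hρR hT v) (by simp) h1)
          ((intervalIntegrable_comp_wallDist hρ hρ0 hρR v h1).mul_const _) fun y hy => ?_
        have hy' := wallDist_mem v hy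
        exact mul_le_mul_of_nonneg_left (Mxw_le_gaussian (hT _ hy').1 (hT _ hy').2 v) (hρ0 _ hy')
    _ = _ := by
      rw [intervalIntegral.integral_mul_const, integral_comp_wallDist_unit, hmass, one_mul]

lemma le_integral_source (hρ : Measurable ρ) (hTm : Measurable T)
    (hρ0 : ∀ y ∈ Icc (0 : ℝ) 1, 0 ≤ ρ y) (hρR : ∀ y ∈ Icc (0 : ℝ) 1, ρ y ≤ R)
    (hT : ∀ y ∈ Icc (0 : ℝ) 1, 1 ≤ T y ∧ T y ≤ T₂) {v : ℝ} (hv : |v| ≤ 2) {x : ℝ}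
    (hx : x ∈ Icc (0 : ℝ) 1) :
    (Real.sqrt (2 * π * T₂))⁻¹ * Real.exp (-2) * (∫ y in (0 : ℝ)..x, ρ (wallDist v y)) ≤
      ∫ y in (0 : ℝ)..x, source ρ T v y := by
  rw [← intervalIntegral.integral_const_mul]
  refine intervalIntegral.integral_mono_on hx.1
    ((intervalIntegrable_comp_wallDist hρ hρ0 hρR v hx).const_mul _)
    (intervalIntegrable_of_bounded (measurable_source hρ hTm v)
      (source_bounds hρ0 hρR hT v) (by simp) hx) fun y hy => ?_
  have hy' := wallDist_mem v (⟨hy.1, hy.2.trans hx.2⟩ : y ∈ Icc (0 : ℝ) 1)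
  rw [mul_comm]
  exact mul_le_mul_of_nonneg_left (le_Mxw (hT _ hy').1 (hT _ hy').2 hv) (hρ0 _ hy')

end Source

lemma inflow_bounds {T₁ T₂ α β A : ℝ} (h1 : 1 ≤ T₁) (h12 : T₁ ≤ T₂) (hα : 0 ≤ α) (hαA : α ≤ A)
    (hβ : 0 ≤ β) (hβA : β ≤ A) (v : ℝ) :
    0 ≤ inflow T₁ T₂ α β v ∧ inflow T₁ T₂ α β v ≤ A * Real.exp (-v ^ 2 / (2 * T₂)) := by
  unfold inflow
  rw [mul_comm A]
  split_ifs
  · exact ⟨mul_nonneg (wallMxw_nonneg (by linarith) v) hα,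
      mul_le_mul (wallMxw_le_gaussian h1 h12 v) hαA hα (Real.exp_nonneg _)⟩
  · exact ⟨mul_nonneg (wallMxw_nonneg (by linarith) v) hβ,
      mul_le_mul (wallMxw_le_gaussian (h1.trans h12) le_rfl v) hβA hβ (Real.exp_nonneg _)⟩

lemma IsMildSteadyState.ae_eq_transportProfile {T₁ T₂ : ℝ} {ρ T : ℝ → ℝ} {f : ℝ → ℝ → ℝ}
    (hf : IsMildSteadyState 1 T₁ T₂ ρ T f) {x : ℝ} (hx : x ∈ Icc (0 : ℝ) 1) :
    ∀ᵐ v : ℝ, v ≠ 0 ∧ f x v = transportProfile |v|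
      (inflow T₁ T₂ ((Cminus 1 ρ T + Cwall 1 T₂ * Cplus 1 ρ T) / (1 - Cwall 1 T₁ * Cwall 1 T₂))
        ((Cplus 1 ρ T + Cwall 1 T₁ * Cminus 1 ρ T) / (1 - Cwall 1 T₁ * Cwall 1 T₂)) v)
      (source ρ T v) (wallDist v x) := by
  obtain ⟨hpos, hneg⟩ := hf.2.2.2.2 x hx
  rw [ae_restrict_iff' measurableSet_Ioi] at hpos
  rw [ae_restrict_iff' measurableSet_Iio] at hneg
  filter_upwards [hpos, hneg, Measure.ae_ne volume (0 : ℝ)] with v h1 h2 h0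
  refine ⟨h0, ?_⟩
  rcases lt_or_gt_of_ne h0 with hv | hv
  · rw [h2 hv]
    have hnv : ¬ 0 < v := not_lt.2 hv.le
    simp only [transportProfile, inflow, source, wallDist, hnv, if_false, one_mul, mul_assoc]
    congr 1
    have := intervalIntegral.integral_comp_sub_left (a := 0) (b := 1 - x)
      (fun y => |v|⁻¹ * (Real.exp (-(y - x) / |v|) * (ρ y * Mxw (T y) v))) 1
    rw [sub_zero, sub_sub_cancel] at this
    rw [← this]
    refine intervalIntegral.integral_congr fun y _ => ?_
    rw [show 1 - y - x = 1 - x - y by ring]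
  · rw [h1 hv]
    simp only [transportProfile, inflow, source, wallDist, if_pos (show 0 < v from hv), one_mul,
      mul_assoc, abs_of_pos (show 0 < v from hv)]

section SteadyState

variable {T₁ T₂ α β A R : ℝ} {ρ T : ℝ → ℝ} {f : ℝ → ℝ → ℝ}

/-- `f` solves the free transport problem with wall fluxes `α`, `β` and source `ρ M_T`. -/
def SolvesTransport (T₁ T₂ α β : ℝ) (ρ T : ℝ → ℝ) (f : ℝ → ℝ → ℝ) : Prop :=
  ∀ x ∈ Icc (0 : ℝ) 1, ∀ᵐ v : ℝ, v ≠ 0 ∧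
    f x v = transportProfile |v| (inflow T₁ T₂ α β v) (source ρ T v) (wallDist v x)

/-- Bounds on the data of the transport problem: the wall fluxes are at most `A`, and `ρ` is a
density of unit mass with values in `[0, R]`. -/
structure AdmissibleData (T₁ T₂ α β A R : ℝ) (ρ T : ℝ → ℝ) : Prop where
  one_le : 1 ≤ T₁
  le : T₁ ≤ T₂
  left_nonneg : 0 ≤ α
  left_le : α ≤ A
  right_nonneg : 0 ≤ β
  right_le : β ≤ A
  measurable_density : Measurable ρ
  measurable_temp : Measurable T
  density_nonneg : ∀ y ∈ Icc (0 : ℝ) 1, 0 ≤ ρ y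
  density_le : ∀ y ∈ Icc (0 : ℝ) 1, ρ y ≤ R
  mass : ∫ y in (0 : ℝ)..1, ρ y = 1
  temp : ∀ y ∈ Icc (0 : ℝ) 1, 1 ≤ T y ∧ T y ≤ T₂

namespace AdmissibleData

lemma bound_nonneg (h : AdmissibleData T₁ T₂ α β A R ρ T) : 0 ≤ R :=
  (h.density_nonneg 0 (by simp)).trans (h.density_le 0 (by simp))

lemma temp_pos (h : AdmissibleData T₁ T₂ α β A R ρ T) : 0 < T₂ := by
  linarith [h.one_le, h.le]

lemma density_le_of_flux (h : AdmissibleData T₁ T₂ α β A R ρ T)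
    (hf : SolvesTransport T₁ T₂ α β ρ T f) (hf0 : ∀ x v, 0 ≤ f x v) {x : ℝ}
    (hx : x ∈ Icc (0 : ℝ) 1) :
    ∫ v, f x v ≤ A * (∫ v : ℝ, Real.exp (-v ^ 2 / (2 * T₂))) +
      Real.sqrt R * ∫ v : ℝ, (Real.sqrt |v|)⁻¹ * Real.exp (-v ^ 2 / (2 * T₂)) := by
  have hi₁ := (integrable_gaussian h.temp_pos).const_mul A
  have hi₂ := (integrable_inv_sqrt_abs_mul_gaussian h.temp_pos).const_mul (Real.sqrt R)
  rw [← integral_const_mul, ← integral_const_mul, ← integral_add hi₁ hi₂]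
  refine integral_mono_of_nonneg (ae_of_all _ (hf0 x)) (hi₁.add hi₂) ?_
  filter_upwards [hf x hx] with v ⟨hv, hfv⟩
  have hb := inflow_bounds h.one_le h.le h.left_nonneg h.left_le h.right_nonneg h.right_le v
  have := transportProfile_le_sqrt (abs_pos.2 hv) hb.1 h.bound_nonneg (Real.exp_nonneg _)
    (measurable_source h.measurable_density h.measurable_temp v)
    (source_bounds h.density_nonneg h.density_le h.temp v)
    (integral_source_le h.measurable_density h.measurable_temp h.density_nonneg h.density_le
      h.mass h.temp v) (wallDist_mem v hx)
  change f x v ≤ _ + _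
  rw [hfv]
  linarith [hb.2]

lemma pressure_le (h : AdmissibleData T₁ T₂ α β A R ρ T)
    (hf : SolvesTransport T₁ T₂ α β ρ T f) (hf0 : ∀ x v, 0 ≤ f x v) {x : ℝ}
    (hx : x ∈ Icc (0 : ℝ) 1) :
    ∫ v, v ^ 2 * f x v ≤ (A + R) * ∫ v : ℝ, v ^ 2 * Real.exp (-v ^ 2 / (2 * T₂)) := by
  rw [← integral_const_mul]
  refine integral_mono_of_nonneg (ae_of_all _ fun v => mul_nonneg (sq_nonneg v) (hf0 x v))
    ((integrable_sq_mul_gaussian h.temp_pos).const_mul _) ?_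
  filter_upwards [hf x hx] with v ⟨hv, hfv⟩
  have hb := inflow_bounds h.one_le h.le h.left_nonneg h.left_le h.right_nonneg h.right_le v
  have := transportProfile_le (abs_pos.2 hv) hb.1
    (mul_nonneg h.bound_nonneg (Real.exp_nonneg (-v ^ 2 / (2 * T₂))))
    (measurable_source h.measurable_density h.measurable_temp v)
    (source_bounds h.density_nonneg h.density_le h.temp v) (wallDist_mem v hx)
  have hfle : f x v ≤ (A + R) * Real.exp (-v ^ 2 / (2 * T₂)) := by
    rw [hfv]; linarith [hb.2]
  calc v ^ 2 * f x v ≤ v ^ 2 * ((A + R) * Real.exp (-v ^ 2 / (2 * T₂))) := by gcongr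
    _ = _ := by ring

lemma abs_density_sub_le (h : AdmissibleData T₁ T₂ α β A R ρ T)
    (hf : SolvesTransport T₁ T₂ α β ρ T f) {x₁ x₂ : ℝ}
    (hx₁ : x₁ ∈ Icc (0 : ℝ) 1) (hx₂ : x₂ ∈ Icc (0 : ℝ) 1)
    (hi₁ : Integrable (f x₁)) (hi₂ : Integrable (f x₂)) :
    |(∫ v, f x₁ v) - ∫ v, f x₂ v| ≤ (A + R) * Real.sqrt |x₁ - x₂| *
      ∫ v : ℝ, (Real.sqrt |v|)⁻¹ * Real.exp (-v ^ 2 / (2 * T₂)) := by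
  rw [← integral_sub hi₁ hi₂, ← integral_const_mul, ← Real.norm_eq_abs]
  refine norm_integral_le_of_norm_le
    ((integrable_inv_sqrt_abs_mul_gaussian h.temp_pos).const_mul _) ?_
  filter_upwards [hf x₁ hx₁, hf x₂ hx₂] with v ⟨hv, hfv₁⟩ ⟨_, hfv₂⟩
  have hb := inflow_bounds h.one_le h.le h.left_nonneg h.left_le h.right_nonneg h.right_le v
  have := abs_transportProfile_sub_le (abs_pos.2 hv) hb.1
    (measurable_source h.measurable_density h.measurable_temp v)
    (source_bounds h.density_nonneg h.density_le h.temp v)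
    (wallDist_mem v hx₁) (wallDist_mem v hx₂)
  rw [abs_wallDist_sub] at this
  rw [Real.norm_eq_abs, hfv₁, hfv₂]
  refine this.trans ?_
  calc _ ≤ (A * Real.exp (-v ^ 2 / (2 * T₂)) + R * Real.exp (-v ^ 2 / (2 * T₂))) *
        Real.sqrt |x₁ - x₂| * (Real.sqrt |v|)⁻¹ := by gcongr; exact hb.2
    _ = _ := by ring

lemma le_of_one_le_abs_le_two (h : AdmissibleData T₁ T₂ α β A R ρ T) {x v : ℝ}
    (hx : x ∈ Icc (0 : ℝ) 1) (hv1 : 1 ≤ |v|) (hv2 : |v| ≤ 2) :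
    2⁻¹ * Real.exp (-1) * ((Real.sqrt (2 * π * T₂))⁻¹ * Real.exp (-2)) *
      (if 0 < v then ∫ y in (0 : ℝ)..x, ρ y else ∫ y in x..1, ρ y) ≤
    transportProfile |v| (inflow T₁ T₂ α β v) (source ρ T v) (wallDist v x) := by
  have hv : 0 < |v| := by linarith
  have hb := inflow_bounds h.one_le h.le h.left_nonneg h.left_le h.right_nonneg h.right_le v
  have hw := wallDist_mem v hx
  have hs := source_bounds h.density_nonneg h.density_le h.temp v
  have h1 := le_integral_transport hv
    (measurable_source h.measurable_density h.measurable_temp v) hs hw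
  have h2 := le_integral_source h.measurable_density h.measurable_temp h.density_nonneg
    h.density_le h.temp hv2 hw
  have h3 : 0 ≤ ∫ y in (0 : ℝ)..wallDist v x, source ρ T v y :=
    intervalIntegral.integral_nonneg hw.1 fun y hy => (hs y ⟨hy.1, hy.2.trans hw.2⟩).1
  have h4 : 2⁻¹ * Real.exp (-1) ≤ |v|⁻¹ * Real.exp (-1 / |v|) := by
    have : (-1 : ℝ) ≤ -1 / |v| := by rw [le_div_iff₀ hv]; linarith
    gcongr
  have h5 : 0 ≤ Real.exp (-wallDist v x / |v|) * inflow T₁ T₂ α β v :=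
    mul_nonneg (Real.exp_nonneg _) hb.1
  rw [← integral_comp_wallDist, mul_assoc]
  calc _ ≤ 2⁻¹ * Real.exp (-1) * ∫ y in (0 : ℝ)..wallDist v x, source ρ T v y := by gcongr
    _ ≤ |v|⁻¹ * Real.exp (-1 / |v|) * ∫ y in (0 : ℝ)..wallDist v x, source ρ T v y := by gcongr
    _ ≤ _ := h1
    _ ≤ _ := by unfold transportProfile; linarith

lemma le_density (h : AdmissibleData T₁ T₂ α β A R ρ T)
    (hf : SolvesTransport T₁ T₂ α β ρ T f) (hf0 : ∀ x v, 0 ≤ f x v) {x : ℝ}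
    (hx : x ∈ Icc (0 : ℝ) 1) (hi : Integrable (f x)) :
    2⁻¹ * Real.exp (-1) * ((Real.sqrt (2 * π * T₂))⁻¹ * Real.exp (-2)) ≤ ∫ v, f x v := by
  set L := 2⁻¹ * Real.exp (-1) * ((Real.sqrt (2 * π * T₂))⁻¹ * Real.exp (-2)) with hL
  have hρb : ∀ y ∈ Icc (0 : ℝ) 1, 0 ≤ ρ y ∧ ρ y ≤ R :=
    fun y hy => ⟨h.density_nonneg y hy, h.density_le y hy⟩
  have hsplit := intervalIntegral.integral_add_adjacent_intervals
    (intervalIntegrable_of_bounded h.measurable_density hρb (s := 0) (by simp) hx)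
    (intervalIntegrable_of_bounded h.measurable_density hρb hx (t := 1) (by simp))
  rw [h.mass] at hsplit
  have hvol : volume.real (Icc (1 : ℝ) 2) = 1 ∧ volume.real (Icc (-2 : ℝ) (-1)) = 1 := by
    constructor <;> rw [Real.volume_real_Icc] <;> norm_num
  have hright : L * (∫ y in (0 : ℝ)..x, ρ y) ≤ ∫ v in Icc (1 : ℝ) 2, f x v := by
    have : ∫ _ in Icc (1 : ℝ) 2, L * (∫ y in (0 : ℝ)..x, ρ y) = L * (∫ y in (0 : ℝ)..x, ρ y) := by
      rw [setIntegral_const, hvol.1, one_smul]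
    rw [← this]
    refine setIntegral_mono_on_ae (integrable_const _) hi.integrableOn measurableSet_Icc ?_
    filter_upwards [hf x hx] with v ⟨_, hfv⟩ hv
    have hpos : 0 < v := by linarith [hv.1]
    have := h.le_of_one_le_abs_le_two hx (v := v) (by rw [abs_of_pos hpos]; exact hv.1)
      (by rw [abs_of_pos hpos]; exact hv.2)
    rwa [if_pos hpos, ← hfv] at this
  have hleft : L * (∫ y in x..1, ρ y) ≤ ∫ v in Icc (-2 : ℝ) (-1), f x v := by
    have : ∫ _ in Icc (-2 : ℝ) (-1), L * (∫ y in x..1, ρ y) = L * (∫ y in x..1, ρ y) := by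
      rw [setIntegral_const, hvol.2, one_smul]
    rw [← this]
    refine setIntegral_mono_on_ae (integrable_const _) hi.integrableOn measurableSet_Icc ?_
    filter_upwards [hf x hx] with v ⟨_, hfv⟩ hv
    have hneg : v < 0 := by linarith [hv.2]
    have := h.le_of_one_le_abs_le_two hx (v := v) (by rw [abs_of_neg hneg]; linarith [hv.2])
      (by rw [abs_of_neg hneg]; linarith [hv.1])
    rwa [if_neg (not_lt.2 hneg.le), ← hfv] at this
  have hdisj : Disjoint (Icc (1 : ℝ) 2) (Icc (-2 : ℝ) (-1)) :=
    Set.disjoint_left.2 fun v h₁ h₂ => by linarith [h₁.1, h₂.2]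
  have hunion := setIntegral_union hdisj measurableSet_Icc hi.integrableOn hi.integrableOn
  have htot := setIntegral_le_integral (s := Icc (1 : ℝ) 2 ∪ Icc (-2 : ℝ) (-1)) hi
    (ae_of_all _ (hf0 x))
  calc L = L * (∫ y in (0 : ℝ)..x, ρ y) + L * (∫ y in x..1, ρ y) := by
        rw [← mul_add, hsplit, mul_one]
    _ ≤ _ := by linarith

end AdmissibleData

lemma IsMildSteadyState.wallFlux_bounds (hf : IsMildSteadyState 1 T₁ T₂ ρ T f) (h1 : 1 ≤ T₁)
    (h12 : T₁ ≤ T₂) (hρ0 : ∀ y ∈ Icc (0 : ℝ) 1, 0 ≤ ρ y)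
    (hmass : ∫ y in Icc (0 : ℝ) 1, ρ y = 1) (hT : ∀ y ∈ Icc (0 : ℝ) 1, 1 ≤ T y ∧ T y ≤ T₂) :
    let D := 1 - Cwall 1 T₁ * Cwall 1 T₂
    let A := (1 + Cwall 1 T₁ + Cwall 1 T₂) * (∫ v : ℝ, Real.exp (-v ^ 2 / (2 * T₂))) / D
    (0 ≤ (Cminus 1 ρ T + Cwall 1 T₂ * Cplus 1 ρ T) / D ∧
      (Cminus 1 ρ T + Cwall 1 T₂ * Cplus 1 ρ T) / D ≤ A) ∧
    (0 ≤ (Cplus 1 ρ T + Cwall 1 T₁ * Cminus 1 ρ T) / D ∧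
      (Cplus 1 ρ T + Cwall 1 T₁ * Cminus 1 ρ T) / D ≤ A) := by
  intro D A
  have hD : 0 < D := sub_pos.2 hf.1
  have hC₁ := Cwall_nonneg 1 (show 0 < T₁ by linarith)
  have hC₂ := Cwall_nonneg 1 (show 0 < T₂ by linarith)
  have hm := attenuated_mass_bounds (s := fun y => y) (show 0 < T₂ by linarith) hρ0 hmass hT
    (fun y hy => hy.1)
  have hp := attenuated_mass_bounds (s := fun y => 1 - y) (show 0 < T₂ by linarith) hρ0 hmass hT
    (fun y hy => by linarith [hy.2])
  have hm' : Cminus 1 ρ T = ∫ y in Icc (0 : ℝ) 1,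
      ρ y * ∫ v in Ioi (0 : ℝ), Real.exp (-y / v) * Mxw (T y) v := by simp [Cminus]
  have hp' : Cplus 1 ρ T = ∫ y in Icc (0 : ℝ) 1,
      ρ y * ∫ v in Ioi (0 : ℝ), Real.exp (-(1 - y) / v) * Mxw (T y) v := by simp [Cplus]
  simp only [← hm'] at hm
  simp only [← hp'] at hp
  refine ⟨⟨div_nonneg (add_nonneg hm.1 (mul_nonneg hC₂ hp.1)) hD.le, ?_⟩,
    ⟨div_nonneg (add_nonneg hp.1 (mul_nonneg hC₁ hm.1)) hD.le, ?_⟩⟩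
  · refine div_le_div_of_nonneg_right ?_ hD.le
    nlinarith [mul_le_mul_of_nonneg_left hp.2 hC₂, mul_nonneg hC₁ (hm.1.trans hm.2)]
  · refine div_le_div_of_nonneg_right ?_ hD.le
    nlinarith [mul_le_mul_of_nonneg_left hm.2 hC₁, mul_nonneg hC₂ (hm.1.trans hm.2)]

end SteadyState

lemma sSup_le_of_le_sqrt_sSup {s : Set ℝ} (hs : s.Nonempty) (hs0 : ∀ r ∈ s, 0 ≤ r) {a c : ℝ}
    (h : ∀ r ∈ s, r ≤ a + Real.sqrt (sSup s) * c) : sSup s ≤ 2 * a + c ^ 2 := by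
  have h1 : sSup s ≤ a + Real.sqrt (sSup s) * c := csSup_le hs h
  have h2 : Real.sqrt (sSup s) ^ 2 = sSup s := Real.sq_sqrt (Real.sSup_nonneg hs0)
  nlinarith [sq_nonneg (Real.sqrt (sSup s) - c)]

lemma abs_div_sub_div_le {P Q r s L δ : ℝ} (hP : 0 ≤ P) (hPQ : P ≤ Q) (hL : 0 < L) (hr : L ≤ r)
    (hs : L ≤ s) (hδ : |r - s| ≤ δ) : |P / r - P / s| ≤ Q * δ / L ^ 2 := by
  have hr0 : 0 < r := hL.trans_le hr
  have hs0 : 0 < s := hL.trans_le hs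
  have heq : P / r - P / s = P * (s - r) / (r * s) := by field_simp
  rw [heq, abs_div, abs_mul, abs_of_nonneg hP, abs_of_pos (mul_pos hr0 hs0), abs_sub_comm s r]
  have : L ^ 2 ≤ r * s := by rw [sq]; gcongr
  have hδ0 := (abs_nonneg _).trans hδ
  have hQ := hP.trans hPQ
  gcongr

/-- the output temperature profile `τ = P/ρ` is `1/2`-Hölder continuous
with modulus depending only on `T₁, T₂`. -/
theorem temperature_holder_continuous :
    ∃ Θ : ℝ, 1 ≤ Θ ∧
      ∀ T₁ T₂ : ℝ, Θ ≤ T₁ → T₁ ≤ T₂ →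
        ∃ C : ℝ, 0 < C ∧
          ∀ ρ T : ℝ → ℝ, Measurable ρ → (∀ y ∈ Icc (0 : ℝ) 1, 0 < ρ y) →
            (∃ B : ℝ, ∀ y ∈ Icc (0 : ℝ) 1, ρ y ≤ B) →
            (∫ y in Icc (0 : ℝ) 1, ρ y) = 1 →
            Measurable T → (∀ y, 0 < T y) →
            (∀ y ∈ Icc (0 : ℝ) 1, T₁ ≤ T y ∧ T y ≤ T₂) →
            ∀ f : ℝ → ℝ → ℝ, (∀ x v, 0 ≤ f x v) →
              IsMildSteadyState 1 T₁ T₂ ρ T f →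
              (∀ x₁ ∈ Icc (0 : ℝ) 1, ∀ x₂ ∈ Icc (0 : ℝ) 1,
                (∫ v, v ^ 2 * f x₁ v) = ∫ v, v ^ 2 * f x₂ v) →
              ∀ x₁ ∈ Icc (0 : ℝ) 1, ∀ x₂ ∈ Icc (0 : ℝ) 1,
                |(∫ v, v ^ 2 * f x₁ v) / ρ x₁ - (∫ v, v ^ 2 * f x₂ v) / ρ x₂| ≤
                  C * Real.sqrt |x₁ - x₂| := by
  refine ⟨1, le_rfl, fun T₁ T₂ h1 h12 => ?_⟩
  set c₀ := ∫ v : ℝ, Real.exp (-v ^ 2 / (2 * T₂)) with hc₀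
  set c₁ := ∫ v : ℝ, (Real.sqrt |v|)⁻¹ * Real.exp (-v ^ 2 / (2 * T₂)) with hc₁
  set c₂ := ∫ v : ℝ, v ^ 2 * Real.exp (-v ^ 2 / (2 * T₂)) with hc₂
  set A := (1 + Cwall 1 T₁ + Cwall 1 T₂) * c₀ / (1 - Cwall 1 T₁ * Cwall 1 T₂) with hA
  set R := 2 * (A * c₀) + c₁ ^ 2 with hR
  set L := 2⁻¹ * Real.exp (-1) * ((Real.sqrt (2 * π * T₂))⁻¹ * Real.exp (-2)) with hL
  set C := (A + R) * c₂ * ((A + R) * c₁) / L ^ 2 with hC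
  refine ⟨max 1 C, by positivity, ?_⟩
  intro ρ T hρ hρ0 ⟨B, hB⟩ hmass hT _ hTb f hf0 hf hP x₁ hx₁ x₂ hx₂
  have hT₂ : 0 < T₂ := by linarith
  have hL0 : 0 < L := by
    have : 0 < Real.sqrt (2 * π * T₂) := Real.sqrt_pos.2 (by positivity)
    positivity
  have hTb' : ∀ y ∈ Icc (0 : ℝ) 1, 1 ≤ T y ∧ T y ≤ T₂ :=
    fun y hy => ⟨h1.trans (hTb y hy).1, (hTb y hy).2⟩
  have hρ0' : ∀ y ∈ Icc (0 : ℝ) 1, 0 ≤ ρ y := fun y hy => (hρ0 y hy).le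
  obtain ⟨⟨hα, hαA⟩, hβ, hβA⟩ := hf.wallFlux_bounds h1 h12 hρ0' hmass hTb'
  have hsol : SolvesTransport T₁ T₂ _ _ ρ T f := fun x hx => hf.ae_eq_transportProfile hx
  have hmass' : ∫ y in (0 : ℝ)..1, ρ y = 1 := by
    rw [intervalIntegral.integral_of_le zero_le_one, ← integral_Icc_eq_integral_Ioc, hmass]
  have hdata : ∀ r, (∀ y ∈ Icc (0 : ℝ) 1, ρ y ≤ r) → AdmissibleData T₁ T₂ _ _ A r ρ T :=
    fun r hr => ⟨h1, h12, hα, hαA, hβ, hβA, hρ, hT, hρ0', hr, hmass', hTb'⟩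
  have hρf := hf.2.2.2.1
  have hbdd : BddAbove (ρ '' Icc (0 : ℝ) 1) := ⟨B, by rintro _ ⟨y, hy, rfl⟩; exact hB y hy⟩
  have hsup : ∀ y ∈ Icc (0 : ℝ) 1, ρ y ≤ sSup (ρ '' Icc (0 : ℝ) 1) :=
    fun y hy => le_csSup hbdd (mem_image_of_mem ρ hy)
  have hρR : ∀ y ∈ Icc (0 : ℝ) 1, ρ y ≤ R := by
    intro y hy
    refine (hsup y hy).trans (sSup_le_of_le_sqrt_sSup ⟨_, mem_image_of_mem ρ hx₁⟩ ?_ ?_)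
    · rintro _ ⟨z, hz, rfl⟩
      exact hρ0' z hz
    · rintro _ ⟨z, hz, rfl⟩
      rw [hρf z hz]
      exact (hdata _ hsup).density_le_of_flux hsol hf0 hz
  have hd := hdata R hρR
  have hint : ∀ x ∈ Icc (0 : ℝ) 1, Integrable (f x) := fun x hx =>
    Integrable.of_integral_ne_zero (by rw [← hρf x hx]; exact (hρ0 x hx).ne')
  have hlow : ∀ x ∈ Icc (0 : ℝ) 1, L ≤ ρ x := fun x hx => by
    rw [hρf x hx]; exact hd.le_density hsol hf0 hx (hint x hx)
  have hdiff := hd.abs_density_sub_le hsol hx₁ hx₂ (hint x₁ hx₁) (hint x₂ hx₂)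
  rw [← hρf x₁ hx₁, ← hρf x₂ hx₂] at hdiff
  rw [← hP x₁ hx₁ x₂ hx₂]
  calc _ ≤ (A + R) * c₂ * ((A + R) * Real.sqrt |x₁ - x₂| * c₁) / L ^ 2 :=
        abs_div_sub_div_le (integral_nonneg fun v => mul_nonneg (sq_nonneg v) (hf0 x₁ v))
          (hd.pressure_le hsol hf0 hx₁) hL0 (hlow x₁ hx₁) (hlow x₂ hx₂) hdiff
    _ = C * Real.sqrt |x₁ - x₂| := by rw [hC]; ring
    _ ≤ _ := by gcongr; exact le_max_right _ _
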